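/- arXiv:1404.2379 — 3 statements merged into one kernel-verified Lean document; each statement's English description precedes it below -/
import Mathlib

section
/- Suppose for every k ∈ ℂ with Im k ≤ 0, f(k,·) : [0,∞) → ℂ is a continuous solution of the Jost integral equation, and set f'(k,0) := ik − ∫₀^b cos(ky) V(y) f(k,y) dy. Then, as k → ∞ in the closed lower half plane {Im k ≤ 0}, one has k·e^{−2ikb}·( f(k,0) − 1 + W/(2ik) ) → 0 and e^{−2ikb}·( f'(k,0) − ik + W/2 ) → 0; that is, f(k,0) − 1 + W/(2ik) = e^{2ikb}·o(1/k) and f'(k,0) − ik + W/2 = e^{2ikb}·o(1). -/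
open MeasureTheory Set Filter

/-- The kernel `s_k(t) = sin(kt)/k` for `k ≠ 0`, and `s_0(t) = t`. -/
noncomputable def jostKernel (k : ℂ) (t : ℝ) : ℂ :=
  if k = 0 then (t : ℂ) else Complex.sin (k * t) / k

/-- A class-A potential: measurable, integrable on `(0,b)`, vanishing outside `(0,b)`. -/
def ClassA (b : ℝ) (V : ℝ → ℝ) : Prop :=
  Measurable V ∧ IntegrableOn V (Set.Ioo 0 b) ∧ ∀ x, x ∉ Set.Ioo 0 b → V x = 0

/-- `f` is a (continuous) solution of the Jost integral equation at parameter `k`. -/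
def IsJostSolution (b : ℝ) (V : ℝ → ℝ) (k : ℂ) (f : ℝ → ℂ) : Prop :=
  ContinuousOn f (Set.Ici 0) ∧
  (∀ x : ℝ, 0 ≤ x → x ≤ b →
      f x = Complex.exp (Complex.I * k * x)
        + ∫ y in x..b, jostKernel k (y - x) * (V y : ℂ) * f y) ∧
  ∀ x : ℝ, b ≤ x → f x = Complex.exp (Complex.I * k * x)

lemma ClassA.integrable {b : ℝ} {V : ℝ → ℝ} (hV : ClassA b V) : Integrable V := by
  rw [← integrableOn_iff_integrable_of_support_subset (s := Ioo 0 b)]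
  · exact hV.2.1
  · intro x hx
    by_contra h
    exact hx (hV.2.2 x h)

lemma norm_intervalIntegral_le_const_mul_integral_norm {V h : ℝ → ℂ} (hV : Integrable V)
    {a b C : ℝ} (hab : a ≤ b) (hC : 0 ≤ C) (hh : ∀ y ∈ Ioc a b, ‖h y‖ ≤ C * ‖V y‖) :
    ‖∫ y in a..b, h y‖ ≤ C * ∫ y, ‖V y‖ := by
  calc ‖∫ y in a..b, h y‖ ≤ ∫ y in a..b, C * ‖V y‖ :=
        intervalIntegral.norm_integral_le_of_norm_le hab
          (.of_forall hh) (hV.norm.const_mul C).intervalIntegrable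
    _ ≤ ∫ y, C * ‖V y‖ := by
        rw [intervalIntegral.integral_of_le hab]
        exact setIntegral_le_integral (hV.norm.const_mul C)
          (.of_forall fun y => mul_nonneg hC (norm_nonneg _))
    _ = C * ∫ y, ‖V y‖ := integral_const_mul _ _

lemma norm_exp_I_mul (k : ℂ) (x : ℝ) :
    ‖Complex.exp (Complex.I * k * x)‖ = Real.exp (-k.im * x) := by
  simp [Complex.norm_exp]

lemma norm_exp_mul_I_le {k : ℂ} (hk : k.im ≤ 0) {t : ℝ} (ht : 0 ≤ t) :
    ‖Complex.exp (k * t * Complex.I)‖ ≤ Real.exp (-k.im * t) ∧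
      ‖Complex.exp (-(k * t) * Complex.I)‖ ≤ Real.exp (-k.im * t) := by
  have := mul_nonneg_of_nonpos_of_nonpos hk (neg_nonpos.2 ht)
  constructor <;> (simp [Complex.norm_exp]; try nlinarith)

lemma norm_cos_mul_ofReal_le {k : ℂ} (hk : k.im ≤ 0) {t : ℝ} (ht : 0 ≤ t) :
    ‖Complex.cos (k * t)‖ ≤ Real.exp (-k.im * t) := by
  obtain ⟨h₁, h₂⟩ := norm_exp_mul_I_le hk ht
  rw [Complex.cos, norm_div, Complex.norm_ofNat]
  linarith [norm_add_le (Complex.exp (k * t * Complex.I)) (Complex.exp (-(k * t) * Complex.I))]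

lemma norm_sin_mul_ofReal_le {k : ℂ} (hk : k.im ≤ 0) {t : ℝ} (ht : 0 ≤ t) :
    ‖Complex.sin (k * t)‖ ≤ Real.exp (-k.im * t) := by
  obtain ⟨h₁, h₂⟩ := norm_exp_mul_I_le hk ht
  rw [Complex.sin, norm_div, norm_mul, Complex.norm_I, mul_one, Complex.norm_ofNat]
  linarith [norm_sub_le (Complex.exp (-(k * t) * Complex.I)) (Complex.exp (k * t * Complex.I))]

lemma IsJostSolution.norm_sub_exp_le_of_bound {b : ℝ} {V : ℝ → ℝ} {k : ℂ} {f : ℝ → ℂ}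
    (hf : IsJostSolution b V k f) (hV : Integrable V) (hk : k.im ≤ 0) (hk0 : k ≠ 0)
    {M : ℝ} (hM0 : 0 ≤ M)
    (hM : ∀ y ∈ Icc 0 b, ‖f y‖ ≤ M * Real.exp (-k.im * (2 * b - y)))
    {x : ℝ} (hx : x ∈ Icc 0 b) :
    ‖f x - Complex.exp (Complex.I * k * x)‖
      ≤ M * Real.exp (-k.im * (2 * b - x)) / ‖k‖ * ∫ y, ‖(V y : ℂ)‖ := by
  rw [hf.2.1 x hx.1 hx.2, add_sub_cancel_left]
  have hVc : Integrable fun y => (V y : ℂ) := hV.ofReal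
  refine norm_intervalIntegral_le_const_mul_integral_norm hVc hx.2 (by positivity) ?_
  intro y hy
  have hs : ‖jostKernel k (y - x)‖ ≤ Real.exp (-k.im * (y - x)) / ‖k‖ := by
    rw [jostKernel, if_neg hk0, norm_div]
    have := norm_sin_mul_ofReal_le hk (sub_nonneg.2 hy.1.le)
    gcongr
  rw [norm_mul, norm_mul]
  calc ‖jostKernel k (y - x)‖ * ‖(V y : ℂ)‖ * ‖f y‖
      ≤ Real.exp (-k.im * (y - x)) / ‖k‖ * ‖(V y : ℂ)‖
          * (M * Real.exp (-k.im * (2 * b - y))) := by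
        gcongr
        exact hM y ⟨hx.1.trans hy.1.le, hy.2⟩
    _ = M * (Real.exp (-k.im * (y - x)) * Real.exp (-k.im * (2 * b - y))) / ‖k‖
          * ‖(V y : ℂ)‖ := by ring
    _ = _ := by
        rw [← Real.exp_add]
        ring_nf

lemma IsJostSolution.norm_le {b : ℝ} (hb : 0 ≤ b) {V : ℝ → ℝ} {k : ℂ} {f : ℝ → ℂ}
    (hf : IsJostSolution b V k f) (hV : Integrable V) (hk : k.im ≤ 0) (hk0 : k ≠ 0)
    (hkV : 2 * ∫ y, ‖(V y : ℂ)‖ ≤ ‖k‖) {x : ℝ} (hx : x ∈ Icc 0 b) :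
    ‖f x‖ ≤ 2 * Real.exp (-k.im * (2 * b - x)) := by
  have hkpos : 0 < ‖k‖ := norm_pos_iff.2 hk0
  have hcont : ContinuousOn (fun y => ‖f y‖ / Real.exp (-k.im * (2 * b - y))) (Icc 0 b) := by
    refine (hf.1.mono Icc_subset_Ici_self).norm.div (by fun_prop) fun y _ => Real.exp_ne_zero _
  obtain ⟨z, hz, hmax⟩ := isCompact_Icc.exists_isMaxOn (nonempty_Icc.2 hb) hcont
  set M := ‖f z‖ / Real.exp (-k.im * (2 * b - z)) with hMdef
  have hM0 : 0 ≤ M := by positivity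
  have hM : ∀ y ∈ Icc 0 b, ‖f y‖ ≤ M * Real.exp (-k.im * (2 * b - y)) := fun y hy =>
    (div_le_iff₀ (Real.exp_pos _)).1 (hmax hy)
  have hle : ‖f z‖ ≤ Real.exp (-k.im * (2 * b - z)) * (1 + M / 2) := by
    have h₁ := hf.norm_sub_exp_le_of_bound hV hk hk0 hM0 hM hz
    have h₂ := norm_le_norm_sub_add (f z) (Complex.exp (Complex.I * k * z))
    have h₃ : Real.exp (-k.im * z) ≤ Real.exp (-k.im * (2 * b - z)) := by
      gcongr
      · linarith
      · linarith [hz.2]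
    have h₄ : M * Real.exp (-k.im * (2 * b - z)) / ‖k‖ * ∫ y, ‖(V y : ℂ)‖
        ≤ M * Real.exp (-k.im * (2 * b - z)) / 2 := by
      rw [div_mul_eq_mul_div, div_le_div_iff₀ hkpos two_pos, mul_assoc, mul_comm _ (2 : ℝ)]
      gcongr
    rw [norm_exp_I_mul] at h₂
    linarith
  have hM2 : M ≤ 2 := by
    have : M ≤ 1 + M / 2 := (div_le_iff₀' (Real.exp_pos _)).2 hle
    linarith
  exact (hM x hx).trans (by gcongr)

/-- The Riemann–Lebesgue lemma on the closed lower half plane, for `C¹` functions. -/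
lemma norm_integral_exp_mul_le_of_contDiff {b : ℝ} (hb : 0 ≤ b) {g : ℝ → ℂ}
    (hg : ContDiff ℝ 1 g) :
    ∃ C : ℝ, 0 ≤ C ∧ ∀ k : ℂ, k.im ≤ 0 → k ≠ 0 →
      ‖∫ y in (0 : ℝ)..b, Complex.exp (-2 * Complex.I * k * (b - y)) * g y‖ ≤ C / ‖k‖ := by
  have hg' : Continuous (deriv g) := hg.continuous_deriv le_rfl
  refine ⟨‖g b‖ + ‖g 0‖ + ∫ y in (0 : ℝ)..b, ‖deriv g y‖, ?_, fun k hk hk0 => ?_⟩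
  · have := intervalIntegral.integral_nonneg (μ := volume) hb fun y _ => norm_nonneg (deriv g y)
    positivity
  have hc : 2 * Complex.I * k ≠ 0 := by simp [hk0]
  have hE : ∀ y ≤ b, ‖Complex.exp (-2 * Complex.I * k * (b - y))‖ ≤ 1 := by
    intro y hy
    rw [Complex.norm_exp, Real.exp_le_one_iff]
    have := mul_nonneg_of_nonpos_of_nonpos hk (sub_nonpos.2 hy)
    simp
    nlinarith
  have hparts := intervalIntegral.integral_mul_deriv_eq_deriv_mul (a := 0) (b := b)
    (u := g) (u' := deriv g)
    (v := fun y : ℝ => Complex.exp (-2 * Complex.I * k * (b - y)))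
    (v' := fun y : ℝ => Complex.exp (-2 * Complex.I * k * (b - y)) * (2 * Complex.I * k))
    (fun y _ => (hg.differentiable one_ne_zero y).hasDerivAt)
    (fun y _ => by
      have h := (((hasDerivAt_id y).ofReal_comp.const_sub (b : ℂ)).const_mul
        (-2 * Complex.I * k)).cexp
      simpa using h)
    (hg'.intervalIntegrable _ _) ((by fun_prop : Continuous _).intervalIntegrable _ _)
  have hfac : ∫ y in (0 : ℝ)..b, g y *
      (Complex.exp (-2 * Complex.I * k * (b - y)) * (2 * Complex.I * k))
      = (2 * Complex.I * k) *
        ∫ y in (0 : ℝ)..b, Complex.exp (-2 * Complex.I * k * (b - y)) * g y := by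
    rw [← intervalIntegral.integral_const_mul]
    congr 1 with y
    ring
  rw [hfac] at hparts
  rw [le_div_iff₀ (norm_pos_iff.2 hk0), mul_comm]
  have hint : ‖∫ y in (0 : ℝ)..b, deriv g y * Complex.exp (-2 * Complex.I * k * (b - y))‖
      ≤ ∫ y in (0 : ℝ)..b, ‖deriv g y‖ := by
    refine intervalIntegral.norm_integral_le_of_norm_le hb (.of_forall fun y hy => ?_)
      (hg'.norm.intervalIntegrable _ _)
    rw [norm_mul]
    exact mul_le_of_le_one_right (norm_nonneg _) (hE y hy.2)
  have hend : ∀ y ≤ b, ‖g y * Complex.exp (-2 * Complex.I * k * (b - y))‖ ≤ ‖g y‖ := by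
    intro y hy
    rw [norm_mul]
    exact mul_le_of_le_one_right (norm_nonneg _) (hE y hy)
  have hn := congrArg norm hparts
  rw [norm_mul, norm_mul, norm_mul, Complex.norm_I, Complex.norm_ofNat, mul_one] at hn
  have h₁ := norm_sub_le (g b * Complex.exp (-2 * Complex.I * k * (b - b))
      - g 0 * Complex.exp (-2 * Complex.I * k * (b - (0 : ℝ))))
    (∫ y in (0 : ℝ)..b, deriv g y * Complex.exp (-2 * Complex.I * k * (b - y)))
  have h₂ := norm_sub_le (g b * Complex.exp (-2 * Complex.I * k * (b - b)))
    (g 0 * Complex.exp (-2 * Complex.I * k * (b - (0 : ℝ))))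
  have h₃ : 0 ≤ ‖k‖ *
      ‖∫ y in (0 : ℝ)..b, Complex.exp (-2 * Complex.I * k * (b - y)) * g y‖ := by positivity
  linarith [hend b le_rfl, hend 0 hb]

/-- The Riemann–Lebesgue lemma on the closed lower half plane. -/
lemma exists_norm_integral_exp_mul_le {b : ℝ} (hb : 0 ≤ b) {V : ℝ → ℂ} (hV : Integrable V)
    {ε : ℝ} (hε : 0 < ε) :
    ∃ R : ℝ, 0 < R ∧ ∀ k : ℂ, k.im ≤ 0 → R ≤ ‖k‖ →
      ‖∫ y in (0 : ℝ)..b, Complex.exp (-2 * Complex.I * k * (b - y)) * V y‖ ≤ ε := by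
  obtain ⟨g, hgs, hg, hVg⟩ := (memLp_one_iff_integrable.2 hV).exist_eLpNorm_sub_le
    ENNReal.one_ne_top le_rfl (half_pos hε)
  have hgi : Integrable g := hg.continuous.integrable_of_hasCompactSupport hgs
  have hdiff : ∫ y, ‖(V - g) y‖ ≤ ε / 2 := by
    rw [integral_norm_eq_lintegral_enorm (hV.sub hgi).aestronglyMeasurable,
      ← eLpNorm_one_eq_lintegral_enorm]
    exact ENNReal.toReal_le_of_le_ofReal (half_pos hε).le hVg
  obtain ⟨C, hC0, hC⟩ := norm_integral_exp_mul_le_of_contDiff hb (hg.of_le (by simp))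
  refine ⟨2 * C / ε + 1, by positivity, fun k hk hR => ?_⟩
  have hkpos : 0 < ‖k‖ := lt_of_lt_of_le (by positivity) hR
  have h₁ := hC k hk (norm_pos_iff.1 hkpos)
  have h₂ : C / ‖k‖ ≤ ε / 2 := by
    have : 2 * C / ε ≤ ‖k‖ := by linarith
    rw [div_le_iff₀ hε] at this
    rw [div_le_iff₀ hkpos]
    linarith
  have h₃ : ‖∫ y in (0 : ℝ)..b, Complex.exp (-2 * Complex.I * k * (b - y)) * (V - g) y‖
      ≤ 1 * ∫ y, ‖(V - g) y‖ := by
    refine norm_intervalIntegral_le_const_mul_integral_norm (hV.sub hgi) hb zero_le_one ?_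
    intro y hy
    rw [norm_mul]
    gcongr
    rw [Complex.norm_exp, Real.exp_le_one_iff]
    have := mul_nonneg_of_nonpos_of_nonpos hk (sub_nonpos.2 hy.2)
    simp
    nlinarith
  have hE : Continuous fun y : ℝ => Complex.exp (-2 * Complex.I * k * (b - y)) := by fun_prop
  have hsplit : ∫ y in (0 : ℝ)..b, Complex.exp (-2 * Complex.I * k * (b - y)) * V y
      = (∫ y in (0 : ℝ)..b, Complex.exp (-2 * Complex.I * k * (b - y)) * (V - g) y)
        + ∫ y in (0 : ℝ)..b, Complex.exp (-2 * Complex.I * k * (b - y)) * g y := by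
    rw [← intervalIntegral.integral_add
      ((hV.sub hgi).intervalIntegrable.continuousOn_mul hE.continuousOn)
      (hgi.intervalIntegrable.continuousOn_mul hE.continuousOn)]
    congr 1 with y
    simp only [Pi.sub_apply]
    ring
  rw [hsplit]
  linarith [norm_add_le
    (∫ y in (0 : ℝ)..b, Complex.exp (-2 * Complex.I * k * (b - y)) * (V - g) y)
    (∫ y in (0 : ℝ)..b, Complex.exp (-2 * Complex.I * k * (b - y)) * g y)]

/-- First Born approximation of `∫₀ᵇ c V f` for a weight `c` behaving like `sin (k ·)` or
`cos (k ·)`. -/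
lemma IsJostSolution.norm_exp_mul_integral_sub_le {b : ℝ} (hb : 0 ≤ b) {V : ℝ → ℝ} {k : ℂ}
    {f : ℝ → ℂ} (hf : IsJostSolution b V k f) (hV : Integrable V) (hk : k.im ≤ 0) (hk0 : k ≠ 0)
    (hkV : 2 * ∫ y, ‖(V y : ℂ)‖ ≤ ‖k‖) {c : ℝ → ℂ} (hc : Continuous c)
    (hcb : ∀ y, 0 ≤ y → ‖c y‖ ≤ Real.exp (-k.im * y)) {α β : ℂ} (hβ : ‖β‖ ≤ 1)
    (hαβ : ∀ y, c y * Complex.exp (Complex.I * k * y)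
      = α + β * Complex.exp (2 * Complex.I * k * y)) :
    ‖Complex.exp (-2 * Complex.I * k * b) *
        ((∫ y in (0 : ℝ)..b, c y * (V y : ℂ) * f y) - α * ((∫ y in (0 : ℝ)..b, V y : ℝ) : ℂ))‖
      ≤ 2 * (∫ y, ‖(V y : ℂ)‖) ^ 2 / ‖k‖
        + ‖∫ y in (0 : ℝ)..b, Complex.exp (-2 * Complex.I * k * (b - y)) * (V y : ℂ)‖ := by
  have hVc : Integrable fun y => (V y : ℂ) := hV.ofReal
  have hVI : IntervalIntegrable (fun y => (V y : ℂ)) volume 0 b := hVc.intervalIntegrable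
  have hfc : ContinuousOn f (uIcc 0 b) := hf.1.mono (by
    rw [uIcc_of_le hb]; exact Icc_subset_Ici_self)
  have hec : Continuous fun y : ℝ => Complex.exp (Complex.I * k * y) := by fun_prop
  have hEc : Continuous fun y : ℝ => Complex.exp (-2 * Complex.I * k * (b - y)) := by fun_prop
  set E := Complex.exp (-2 * Complex.I * k * b) with hEdef
  have hEnorm : ‖E‖ = Real.exp (2 * k.im * b) := by
    simp [hEdef, Complex.norm_exp]
  have hsplit : E * ((∫ y in (0 : ℝ)..b, c y * (V y : ℂ) * f y)
        - α * ((∫ y in (0 : ℝ)..b, V y : ℝ) : ℂ))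
      = E * (∫ y in (0 : ℝ)..b,
            (c y * (f y - Complex.exp (Complex.I * k * y))) * (V y : ℂ))
        + β * ∫ y in (0 : ℝ)..b, Complex.exp (-2 * Complex.I * k * (b - y)) * (V y : ℂ) := by
    rw [← intervalIntegral.integral_ofReal]
    simp only [← intervalIntegral.integral_const_mul]
    rw [← intervalIntegral.integral_sub, ← intervalIntegral.integral_const_mul,
      ← intervalIntegral.integral_add]
    · congr 1 with y
      have h : Complex.exp (-2 * Complex.I * k * (b - y))
          = E * Complex.exp (2 * Complex.I * k * y) := by
        rw [hEdef, ← Complex.exp_add]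
        ring_nf
      rw [h]
      linear_combination (E * V y) * hαβ y
    · exact (hVI.continuousOn_mul
        (hc.continuousOn.mul (hfc.sub hec.continuousOn))).const_mul E
    · exact (hVI.continuousOn_mul hEc.continuousOn).const_mul β
    · refine (hVI.continuousOn_mul (hc.continuousOn.mul hfc)).congr fun y _ => ?_
      simp only [Pi.mul_apply]
      ring
    · exact hVI.const_mul α
  have hrem : ‖∫ y in (0 : ℝ)..b, (c y * (f y - Complex.exp (Complex.I * k * y))) * (V y : ℂ)‖
      ≤ (Real.exp (-k.im * (2 * b)) * (2 / ‖k‖ * ∫ y, ‖(V y : ℂ)‖)) * ∫ y, ‖(V y : ℂ)‖ := by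
    have hN : 0 ≤ ∫ y, ‖(V y : ℂ)‖ := integral_nonneg fun y => norm_nonneg _
    refine norm_intervalIntegral_le_const_mul_integral_norm hVc hb (by positivity) ?_
    intro y hy
    rw [norm_mul, norm_mul]
    refine mul_le_mul_of_nonneg_right ?_ (norm_nonneg _)
    have h := hf.norm_sub_exp_le_of_bound hV hk hk0 zero_le_two
      (fun y hy => hf.norm_le hb hV hk hk0 hkV hy) (Ioc_subset_Icc_self hy)
    calc _ ≤ Real.exp (-k.im * y)
          * (2 * Real.exp (-k.im * (2 * b - y)) / ‖k‖ * ∫ y, ‖(V y : ℂ)‖) :=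
          mul_le_mul (hcb y hy.1.le) h (norm_nonneg _) (Real.exp_pos _).le
      _ = (Real.exp (-k.im * y) * Real.exp (-k.im * (2 * b - y)))
          * (2 / ‖k‖ * ∫ y, ‖(V y : ℂ)‖) := by ring
      _ = _ := by
          rw [← Real.exp_add]
          ring_nf
  rw [hsplit]
  refine (norm_add_le _ _).trans (add_le_add ?_ ?_)
  · rw [norm_mul, hEnorm]
    refine (mul_le_mul_of_nonneg_left hrem (Real.exp_pos _).le).trans_eq ?_
    have : Real.exp (2 * k.im * b) * Real.exp (-k.im * (2 * b)) = 1 := by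
      rw [← Real.exp_add, Real.exp_eq_one_iff]
      ring
    linear_combination (2 / ‖k‖ * (∫ y, ‖(V y : ℂ)‖) ^ 2) * this
  · rw [norm_mul]
    exact mul_le_of_le_one_left (norm_nonneg _) hβ

/-- large-`k` asymptotics of `f(k,0)` and `f'(k,0)` in the closed lower
half plane: `f(k,0) - 1 + W/(2ik) = e^{2ikb}·o(1/k)` and
`f'(k,0) - ik + W/2 = e^{2ikb}·o(1)`. -/
theorem jost_asymptotics_lower (b : ℝ) (hb : 0 < b) (V : ℝ → ℝ) (hV : ClassA b V)
    (f : ℂ → ℝ → ℂ) (hf : ∀ k : ℂ, k.im ≤ 0 → IsJostSolution b V k (f k))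
    (W : ℝ) (hW : W = ∫ y in (0:ℝ)..b, V y)
    (f' : ℂ → ℂ)
    (hf' : ∀ k : ℂ, f' k
      = Complex.I * k - ∫ y in (0:ℝ)..b, Complex.cos (k * y) * (V y : ℂ) * f k y) :
    (∀ ε : ℝ, 0 < ε → ∃ R : ℝ, 0 < R ∧ ∀ k : ℂ, k.im ≤ 0 → R ≤ ‖k‖ →
      ‖k * Complex.exp (-2 * Complex.I * k * b)
        * (f k 0 - 1 + (W : ℂ) / (2 * Complex.I * k))‖ ≤ ε) ∧
    (∀ ε : ℝ, 0 < ε → ∃ R : ℝ, 0 < R ∧ ∀ k : ℂ, k.im ≤ 0 → R ≤ ‖k‖ →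
      ‖Complex.exp (-2 * Complex.I * k * b)
        * (f' k - Complex.I * k + (W : ℂ) / 2)‖ ≤ ε) := by
  have hVi := hV.integrable
  have hVc : Integrable fun y => (V y : ℂ) := hVi.ofReal
  set N := ∫ y, ‖(V y : ℂ)‖ with hN
  have key : ∀ ε : ℝ, 0 < ε → ∃ R : ℝ, 0 < R ∧ ∀ k : ℂ, k.im ≤ 0 → R ≤ ‖k‖ →
      k ≠ 0 ∧ 2 * N ≤ ‖k‖ ∧ 2 * N ^ 2 / ‖k‖
        + ‖∫ y in (0 : ℝ)..b, Complex.exp (-2 * Complex.I * k * (b - y)) * (V y : ℂ)‖ ≤ ε := by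
    intro ε hε
    obtain ⟨R, hR0, hR⟩ :=
      exists_norm_integral_exp_mul_le hb.le hVc (half_pos hε)
    refine ⟨max R (max (2 * N) (4 * N ^ 2 / ε)), lt_max_of_lt_left hR0, fun k hk hkR => ?_⟩
    obtain ⟨h₁, h₂, h₃⟩ : R ≤ ‖k‖ ∧ 2 * N ≤ ‖k‖ ∧ 4 * N ^ 2 / ε ≤ ‖k‖ := by
      simpa using hkR
    have hkpos : 0 < ‖k‖ := hR0.trans_le h₁
    refine ⟨norm_pos_iff.1 hkpos, h₂, ?_⟩
    have h₄ : 2 * N ^ 2 / ‖k‖ ≤ ε / 2 := by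
      rw [div_le_iff₀ hε] at h₃
      rw [div_le_iff₀ hkpos]
      linarith
    linarith [hR k hk h₁]
  refine ⟨fun ε hε => ?_, fun ε hε => ?_⟩ <;> obtain ⟨R, hR0, hR⟩ := key ε hε <;>
    refine ⟨R, hR0, fun k hk hkR => ?_⟩ <;> obtain ⟨hk0, hkN, hle⟩ := hR k hk hkR
  · have h := (hf k hk).norm_exp_mul_integral_sub_le hb.le hVi hk hk0 hkN
      (c := fun y : ℝ => Complex.sin (k * y)) (by fun_prop)
      (fun y hy => norm_sin_mul_ofReal_le hk hy)
      (α := Complex.I / 2) (β := -Complex.I / 2) (by norm_num)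
      (fun y => by
        have h₁ : Complex.exp (2 * Complex.I * k * y)
            = Complex.exp (k * y * Complex.I) * Complex.exp (k * y * Complex.I) := by
          rw [← Complex.exp_add]
          ring_nf
        have h₂ : Complex.exp (-(k * y) * Complex.I) * Complex.exp (k * y * Complex.I) = 1 := by
          rw [← Complex.exp_add]
          simp
        rw [Complex.sin, h₁, show Complex.I * k * y = k * y * Complex.I by ring]
        linear_combination (Complex.I / 2) * h₂)
    refine le_trans (le_of_eq ?_) (h.trans hle)
    have h0 := (hf k hk).2.1 0 le_rfl hb.le
    have hk' : ∫ y in (0 : ℝ)..b, jostKernel k (y - (0 : ℝ)) * (V y : ℂ) * f k y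
        = (∫ y in (0 : ℝ)..b, Complex.sin (k * y) * (V y : ℂ) * f k y) / k := by
      rw [← intervalIntegral.integral_div]
      congr 1 with y
      rw [jostKernel, if_neg hk0, sub_zero]
      ring
    rw [hk'] at h0
    have hI : (W : ℂ) / (2 * Complex.I * k) = -(Complex.I / 2 * W) / k := by
      rw [div_eq_div_iff (by simp [hk0]) hk0]
      linear_combination (W * k) * Complex.I_sq
    rw [h0, ← hW, hI]
    congr 1
    simp only [Complex.ofReal_zero, mul_zero, Complex.exp_zero]
    field_simp
    ring
  · have h := (hf k hk).norm_exp_mul_integral_sub_le hb.le hVi hk hk0 hkN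
      (c := fun y : ℝ => Complex.cos (k * y)) (by fun_prop)
      (fun y hy => norm_cos_mul_ofReal_le hk hy)
      (α := 1 / 2) (β := 1 / 2) (by norm_num)
      (fun y => by
        have h₁ : Complex.exp (2 * Complex.I * k * y)
            = Complex.exp (k * y * Complex.I) * Complex.exp (k * y * Complex.I) := by
          rw [← Complex.exp_add]
          ring_nf
        have h₂ : Complex.exp (-(k * y) * Complex.I) * Complex.exp (k * y * Complex.I) = 1 := by
          rw [← Complex.exp_add]
          simp
        rw [Complex.cos, h₁, show Complex.I * k * y = k * y * Complex.I by ring]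
        linear_combination (1 / 2) * h₂)
    refine le_trans (le_of_eq ?_) (h.trans hle)
    rw [hf' k, ← hW, ← norm_neg]
    congr 1
    ring
end

section
/- Let k ∈ ℂ, let f₊ be a continuous solution of the Jost integral equation at parameter k and f₋ a continuous solution at parameter −k, and define their derivatives by f₊'(x) := ik e^{ikx} − ∫_x^b cos(k(y−x)) V(y) f₊(y) dy and f₋'(x) := −ik e^{−ikx} − ∫_x^b cos(k(y−x)) V(y) f₋(y) dy. Then the Wronskian is constant: f₊(x) f₋'(x) − f₊'(x) f₋(x) = −2ik for every x ≥ 0. -/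
open MeasureTheory Set Filter

/-- The indefinite integral of an interval integrable function is absolutely continuous. -/
theorem absolutelyContinuousOnInterval_integral {E : Type*} [NormedAddCommGroup E]
    [NormedSpace ℝ E] {f : ℝ → E} {a b c : ℝ} (h : IntervalIntegrable f volume a b)
    (hc : c ∈ uIcc a b) :
    AbsolutelyContinuousOnInterval (fun x ↦ ∫ v in c..x, f v) a b := by
  have hn := h.norm.absolutelyContinuousOnInterval_intervalIntegral hc
  unfold AbsolutelyContinuousOnInterval at hn ⊢
  have hint : ∀ x ∈ uIcc a b, ∀ y ∈ uIcc a b, IntervalIntegrable f volume x y :=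
    fun x hx y hy ↦ h.mono_set (uIcc_subset_uIcc hx hy)
  refine squeeze_zero' (Eventually.of_forall fun _ ↦ Finset.sum_nonneg fun _ _ ↦ dist_nonneg)
    ?_ hn
  rw [eventually_inf_principal]
  refine Eventually.of_forall fun E hE ↦ Finset.sum_le_sum fun i hi ↦ ?_
  obtain ⟨h₁, h₂⟩ := hE.1 i hi
  rw [dist_eq_norm, dist_eq_norm,
    intervalIntegral.integral_interval_sub_left (hint _ hc _ h₁) (hint _ hc _ h₂),
    intervalIntegral.integral_interval_sub_left (hint _ hc _ h₁).norm (hint _ hc _ h₂).norm]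
  exact intervalIntegral.norm_integral_le_abs_integral_norm

theorem absolutelyContinuousOnInterval_const {E : Type*} [SeminormedAddCommGroup E] (c : E)
    (a b : ℝ) : AbsolutelyContinuousOnInterval (fun _ ↦ c) a b := by
  simpa [AbsolutelyContinuousOnInterval] using tendsto_const_nhds

theorem jostKernel_neg (k : ℂ) (t : ℝ) : jostKernel (-k) t = jostKernel k t := by
  by_cases hk : k = 0 <;> simp [jostKernel, hk]

theorem continuous_jostKernel (k : ℂ) : Continuous (jostKernel k) := by
  unfold jostKernel
  split_ifs <;> fun_prop

theorem mul_jostKernel (k : ℂ) (t : ℝ) : k * jostKernel k t = Complex.sin (k * t) := by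
  by_cases hk : k = 0
  · simp [hk]
  · simp [jostKernel, hk, mul_div_cancel₀]

theorem jostKernel_sub (k : ℂ) (x y : ℝ) :
    jostKernel k (y - x)
      = Complex.cos (k * x) * jostKernel k y - jostKernel k x * Complex.cos (k * y) := by
  by_cases hk : k = 0
  · simp [jostKernel, hk]
  · simp only [jostKernel, hk, if_false, Complex.ofReal_sub, mul_sub, Complex.sin_sub]
    ring

theorem cos_mul_sub_eq_jostKernel (k : ℂ) (x y : ℝ) :
    Complex.cos (k * (y - x))
      = Complex.cos (k * x) * Complex.cos (k * y)
        + k ^ 2 * jostKernel k x * jostKernel k y := by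
  rw [mul_sub, Complex.cos_sub, ← mul_jostKernel, ← mul_jostKernel]
  ring

theorem exp_eq_cos_add_jostKernel (k : ℂ) (x : ℝ) :
    Complex.exp (Complex.I * k * x)
      = Complex.cos (k * x) + Complex.I * k * jostKernel k x := by
  rw [mul_assoc Complex.I k (jostKernel k x), mul_jostKernel, mul_assoc, mul_comm Complex.I,
    Complex.exp_mul_I]
  ring

theorem cos_sq_add_jostKernel_sq (k : ℂ) (x : ℝ) :
    Complex.cos (k * x) ^ 2 + k ^ 2 * jostKernel k x ^ 2 = 1 := by
  rw [← mul_pow, mul_jostKernel, Complex.cos_sq_add_sin_sq]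

/-- Coefficient of `cos (k x)` in the variation of parameters form of a Jost solution. -/
noncomputable def jostCosCoeff (b : ℝ) (V : ℝ → ℝ) (k : ℂ) (f : ℝ → ℂ) (x : ℝ) : ℂ :=
  1 - ∫ y in b..x, jostKernel k y * ((V y : ℂ) * f y)

/-- Coefficient of `s_k(x)` in the variation of parameters form of a Jost solution. -/
noncomputable def jostSinCoeff (b : ℝ) (V : ℝ → ℝ) (k : ℂ) (f : ℝ → ℂ) (x : ℝ) : ℂ :=
  Complex.I * k + ∫ y in b..x, Complex.cos (k * y) * ((V y : ℂ) * f y)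

namespace IsJostSolution

variable {b : ℝ} {V : ℝ → ℝ} {k : ℂ} {f : ℝ → ℂ}

theorem intervalIntegrable_mul (hf : IsJostSolution b V k f) (hb : 0 < b) (hV : ClassA b V) :
    IntervalIntegrable (fun y ↦ (V y : ℂ) * f y) volume 0 b := by
  have hVi : IntervalIntegrable (fun y ↦ (V y : ℂ)) volume 0 b := by
    rw [intervalIntegrable_iff_integrableOn_Ioo_of_le hb.le]
    exact hV.2.1.ofReal
  refine hVi.mul_continuousOn (hf.1.mono ?_)
  rw [uIcc_of_le hb.le]
  exact Icc_subset_Ici_self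

theorem intervalIntegrable_jostKernel_mul (hf : IsJostSolution b V k f) (hb : 0 < b)
    (hV : ClassA b V) (l : ℂ) :
    IntervalIntegrable (fun y ↦ jostKernel l y * ((V y : ℂ) * f y)) volume 0 b :=
  (hf.intervalIntegrable_mul hb hV).continuousOn_mul (continuous_jostKernel l).continuousOn

theorem intervalIntegrable_cos_mul (hf : IsJostSolution b V k f) (hb : 0 < b)
    (hV : ClassA b V) (l : ℂ) :
    IntervalIntegrable (fun y : ℝ ↦ Complex.cos (l * y) * ((V y : ℂ) * f y)) volume 0 b :=
  (hf.intervalIntegrable_mul hb hV).continuousOn_mul (by fun_prop)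

theorem eq_cos_add_jostKernel (hf : IsJostSolution b V k f) (hb : 0 < b) (hV : ClassA b V)
    {x : ℝ} (hx : x ∈ Icc 0 b) :
    f x = Complex.cos (k * x) * jostCosCoeff b V k f x
      + jostKernel k x * jostSinCoeff b V k f x := by
  have hsub : uIcc b x ⊆ uIcc 0 b := uIcc_subset_uIcc right_mem_uIcc
    (by rwa [uIcc_of_le hb.le])
  have hS := (hf.intervalIntegrable_jostKernel_mul hb hV k).mono_set hsub
  have hC := (hf.intervalIntegrable_cos_mul hb hV k).mono_set hsub
  have key : ∫ y in b..x, jostKernel k (y - x) * (V y : ℂ) * f y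
      = Complex.cos (k * x) * (∫ y in b..x, jostKernel k y * ((V y : ℂ) * f y))
        - jostKernel k x * ∫ y in b..x, Complex.cos (k * y) * ((V y : ℂ) * f y) := by
    rw [← intervalIntegral.integral_const_mul, ← intervalIntegral.integral_const_mul,
      ← intervalIntegral.integral_sub (hS.const_mul _) (hC.const_mul _)]
    refine intervalIntegral.integral_congr fun y _ ↦ ?_
    simp only [jostKernel_sub k x y]
    ring
  rw [hf.2.1 x hx.1 hx.2, intervalIntegral.integral_symm, key, exp_eq_cos_add_jostKernel,
    jostCosCoeff, jostSinCoeff]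
  ring

theorem derivative_eq (hf : IsJostSolution b V k f) (hb : 0 < b) (hV : ClassA b V)
    {x : ℝ} (hx : x ∈ Icc 0 b) :
    Complex.I * k * Complex.exp (Complex.I * k * x)
        - ∫ y in x..b, Complex.cos (k * (y - x)) * (V y : ℂ) * f y
      = Complex.cos (k * x) * jostSinCoeff b V k f x
        - k ^ 2 * jostKernel k x * jostCosCoeff b V k f x := by
  have hsub : uIcc b x ⊆ uIcc 0 b := uIcc_subset_uIcc right_mem_uIcc
    (by rwa [uIcc_of_le hb.le])
  have hS := (hf.intervalIntegrable_jostKernel_mul hb hV k).mono_set hsub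
  have hC := (hf.intervalIntegrable_cos_mul hb hV k).mono_set hsub
  have key : ∫ y in b..x, Complex.cos (k * (y - x)) * (V y : ℂ) * f y
      = Complex.cos (k * x) * (∫ y in b..x, Complex.cos (k * y) * ((V y : ℂ) * f y))
        + k ^ 2 * jostKernel k x * ∫ y in b..x, jostKernel k y * ((V y : ℂ) * f y) := by
    rw [← intervalIntegral.integral_const_mul, ← intervalIntegral.integral_const_mul,
      ← intervalIntegral.integral_add (hC.const_mul _) (hS.const_mul _)]
    refine intervalIntegral.integral_congr fun y _ ↦ ?_
    simp only [cos_mul_sub_eq_jostKernel k x y]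
    ring
  rw [intervalIntegral.integral_symm, key, exp_eq_cos_add_jostKernel, jostCosCoeff,
    jostSinCoeff]
  linear_combination k ^ 2 * jostKernel k x * Complex.I_sq

theorem absolutelyContinuous_jostCosCoeff (hf : IsJostSolution b V k f) (hb : 0 < b)
    (hV : ClassA b V) : AbsolutelyContinuousOnInterval (jostCosCoeff b V k f) 0 b :=
  (absolutelyContinuousOnInterval_const _ _ _).fun_sub
    (absolutelyContinuousOnInterval_integral (hf.intervalIntegrable_jostKernel_mul hb hV k)
      right_mem_uIcc)

theorem absolutelyContinuous_jostSinCoeff (hf : IsJostSolution b V k f) (hb : 0 < b)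
    (hV : ClassA b V) : AbsolutelyContinuousOnInterval (jostSinCoeff b V k f) 0 b :=
  (absolutelyContinuousOnInterval_const _ _ _).fun_add
    (absolutelyContinuousOnInterval_integral (hf.intervalIntegrable_cos_mul hb hV k)
      right_mem_uIcc)

theorem ae_hasDerivAt_jostCosCoeff (hf : IsJostSolution b V k f) (hb : 0 < b)
    (hV : ClassA b V) :
    ∀ᵐ x, x ∈ uIcc 0 b →
      HasDerivAt (jostCosCoeff b V k f) (-(jostKernel k x * ((V x : ℂ) * f x))) x := by
  filter_upwards [(hf.intervalIntegrable_jostKernel_mul hb hV k).ae_hasDerivAt_integral]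
    with x h hx
  exact (h hx b right_mem_uIcc).const_sub 1

theorem ae_hasDerivAt_jostSinCoeff (hf : IsJostSolution b V k f) (hb : 0 < b)
    (hV : ClassA b V) :
    ∀ᵐ x : ℝ, x ∈ uIcc 0 b →
      HasDerivAt (jostSinCoeff b V k f) (Complex.cos (k * x) * ((V x : ℂ) * f x)) x := by
  filter_upwards [(hf.intervalIntegrable_cos_mul hb hV k).ae_hasDerivAt_integral] with x h hx
  exact (h hx b right_mem_uIcc).const_add (Complex.I * k)

/-- The Wronskian of the Jost solutions at `k` and `-k`, in terms of the variation of
parameters coefficients. -/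
theorem coeff_wronskian {g : ℝ → ℂ} (hf : IsJostSolution b V k f)
    (hg : IsJostSolution b V (-k) g) (hb : 0 < b) (hV : ClassA b V) {x : ℝ}
    (hx : x ∈ Icc 0 b) :
    jostCosCoeff b V k f x * jostSinCoeff b V (-k) g x
      - jostSinCoeff b V k f x * jostCosCoeff b V (-k) g x = -2 * Complex.I * k := by
  have hac := ((hf.absolutelyContinuous_jostCosCoeff hb hV).fun_smul
      (hg.absolutelyContinuous_jostSinCoeff hb hV)).fun_sub
    ((hf.absolutelyContinuous_jostSinCoeff hb hV).fun_smul
      (hg.absolutelyContinuous_jostCosCoeff hb hV))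
  simp only [smul_eq_mul] at hac
  obtain ⟨w, hw⟩ := hac.const_of_ae_hasDerivAt_zero (by
    filter_upwards [hf.ae_hasDerivAt_jostCosCoeff hb hV, hf.ae_hasDerivAt_jostSinCoeff hb hV,
      hg.ae_hasDerivAt_jostCosCoeff hb hV, hg.ae_hasDerivAt_jostSinCoeff hb hV]
      with t hAf hBf hAg hBg ht
    refine (((hAf ht).mul (hBg ht)).sub ((hBf ht).mul (hAg ht))).congr_deriv ?_
    rw [uIcc_of_le hb.le] at ht
    have ef := hf.eq_cos_add_jostKernel hb hV ht
    have eg := hg.eq_cos_add_jostKernel hb hV ht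
    simp only [jostKernel_neg, neg_mul, Complex.cos_neg] at eg ⊢
    linear_combination (V t : ℂ) * f t * eg - (V t : ℂ) * g t * ef)
  have hxw := hw x (by rwa [uIcc_of_le hb.le])
  have hbw := hw b right_mem_uIcc
  rw [hxw, ← hbw]
  simp only [jostCosCoeff, jostSinCoeff, intervalIntegral.integral_same]
  ring

end IsJostSolution

theorem ClassA.integral_mul_eq_zero {b : ℝ} {V : ℝ → ℝ} (hV : ClassA b V) {x : ℝ} (hx : b ≤ x)
    (g h : ℝ → ℂ) : ∫ y in x..b, g y * (V y : ℂ) * h y = 0 := by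
  refine intervalIntegral.integral_zero_ae (Eventually.of_forall fun y hy ↦ ?_)
  rw [uIoc_of_ge hx] at hy
  simp [hV.2.2 y fun hy' ↦ hy'.2.not_gt hy.1]

/-- the Wronskian of the Jost solutions at `k` and `-k` is constant,
equal to `-2ik`. -/
theorem jost_wronskian (b : ℝ) (hb : 0 < b) (V : ℝ → ℝ) (hV : ClassA b V)
    (k : ℂ)
    (fp : ℝ → ℂ) (hfp : IsJostSolution b V k fp)
    (fm : ℝ → ℂ) (hfm : IsJostSolution b V (-k) fm)
    (fp' fm' : ℝ → ℂ)
    (hfp' : ∀ x : ℝ, fp' x = Complex.I * k * Complex.exp (Complex.I * k * x)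
      - ∫ y in x..b, Complex.cos (k * (y - x)) * (V y : ℂ) * fp y)
    (hfm' : ∀ x : ℝ, fm' x = -Complex.I * k * Complex.exp (-Complex.I * k * x)
      - ∫ y in x..b, Complex.cos (k * (y - x)) * (V y : ℂ) * fm y) :
    ∀ x : ℝ, 0 ≤ x → fp x * fm' x - fp' x * fm x = -2 * Complex.I * k := by
  intro x hx
  have hm : -Complex.I * k = Complex.I * -k := by ring
  rw [hfp', hfm', hm]
  rcases le_total x b with hxb | hxb
  · have hxI : x ∈ Icc 0 b := ⟨hx, hxb⟩
    have hc : ∀ y : ℝ, Complex.cos (k * (y - x)) = Complex.cos (-k * (y - x)) := fun y ↦ by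
      rw [neg_mul, Complex.cos_neg]
    have hdm := hfm.derivative_eq hb hV hxI
    simp only [← hc] at hdm
    rw [hfp.derivative_eq hb hV hxI, hdm, hfp.eq_cos_add_jostKernel hb hV hxI,
      hfm.eq_cos_add_jostKernel hb hV hxI, ← hfp.coeff_wronskian hfm hb hV hxI]
    simp only [jostKernel_neg, neg_mul, Complex.cos_neg]
    linear_combination (jostCosCoeff b V k fp x * jostSinCoeff b V (-k) fm x
      - jostSinCoeff b V k fp x * jostCosCoeff b V (-k) fm x) * cos_sq_add_jostKernel_sq k x
  · rw [hV.integral_mul_eq_zero hxb, hV.integral_mul_eq_zero hxb, hfp.2.2 x hxb,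
      hfm.2.2 x hxb]
    have he : Complex.exp (Complex.I * k * x) * Complex.exp (Complex.I * -k * x) = 1 := by
      rw [← Complex.exp_add, ← Complex.exp_zero]
      ring_nf
    linear_combination -2 * Complex.I * k * he
end

section
/- Let c ∈ ℝ and k ∈ ℂ with k ≠ 0. Let f₊ be a continuous solution of the Jost integral equation at parameter k and f₋ a continuous solution at parameter −k, with derivatives at 0 defined by f₊'(0) := ik − ∫₀^b cos(ky)V(y)f₊(y)dy and f₋'(0) := −ik − ∫₀^b cos(ky)V(y)f₋(y)dy, and define F(k) := −i[ f₊'(0) + c f₊(0) ] and F(−k) := −i[ f₋'(0) + c f₋(0) ]. Then the combination φ(x) := (1/(2k))·[ F(k) f₋(x) − F(−k) f₊(x) ] satisfies the regular-solution initial conditions: φ(0) = 1 and (1/(2k))·[ F(k) f₋'(0) − F(−k) f₊'(0) ] = −c. -/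
open MeasureTheory Set Filter

theorem AbsolutelyContinuousOnInterval.congr_on_uIcc {X : Type*} [PseudoMetricSpace X]
    {f g : ℝ → X} {a b : ℝ} (hf : AbsolutelyContinuousOnInterval f a b)
    (hfg : EqOn f g (uIcc a b)) : AbsolutelyContinuousOnInterval g a b := by
  unfold AbsolutelyContinuousOnInterval at hf ⊢
  refine hf.congr' ?_
  rw [EventuallyEq, eventually_inf_principal]
  filter_upwards with E hE
  refine Finset.sum_congr rfl fun i hi ↦ ?_
  rw [hfg (hE.1 i hi).1, hfg (hE.1 i hi).2]

theorem IntervalIntegrable.absolutelyContinuousOnInterval_integral_complex {g : ℝ → ℂ}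
    {a b c : ℝ} (hg : IntervalIntegrable g volume a b) (hc : c ∈ uIcc a b) :
    AbsolutelyContinuousOnInterval (fun x ↦ ∫ t in c..x, g t) a b := by
  have hre : IntervalIntegrable (fun t ↦ (g t).re) volume a b := ⟨hg.1.re, hg.2.re⟩
  have him : IntervalIntegrable (fun t ↦ (g t).im) volume a b := ⟨hg.1.im, hg.2.im⟩
  have hconst (z : ℂ) : AbsolutelyContinuousOnInterval (fun _ : ℝ ↦ z) a b :=
    ContDiffOn.absolutelyContinuousOnInterval contDiffOn_const
  have hsum :=
    ((hre.absolutelyContinuousOnInterval_intervalIntegral hc).smul (hconst 1)).add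
      ((him.absolutelyContinuousOnInterval_intervalIntegral hc).smul (hconst Complex.I))
  refine hsum.congr_on_uIcc fun x hx ↦ ?_
  have hgx : IntervalIntegrable g volume c x := hg.mono_set (uIcc_subset_uIcc hc hx)
  apply Complex.ext
  · simpa using (Complex.reCLM.intervalIntegral_comp_comm hgx)
  · simpa using (Complex.imCLM.intervalIntegral_comp_comm hgx)

theorem ClassA.intervalIntegrable_mul {b : ℝ} (hb : 0 < b) {V : ℝ → ℝ} (hV : ClassA b V)
    {f : ℝ → ℂ} (hf : ContinuousOn f (Ici 0)) {g : ℝ → ℂ} (hg : Continuous g) :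
    IntervalIntegrable (fun y ↦ g y * (V y : ℂ) * f y) volume 0 b := by
  have hVi : IntervalIntegrable (fun y ↦ (V y : ℂ)) volume 0 b := by
    rw [intervalIntegrable_iff_integrableOn_Ioo_of_le hb.le]
    exact hV.2.1.ofReal
  refine (hVi.continuousOn_mul hg.continuousOn).mul_continuousOn (hf.mono ?_)
  rw [uIcc_of_le hb.le]
  exact Icc_subset_Ici_self

/-- Separation of variables in the integral against the Jost kernel. -/
theorem ClassA.mul_integral_jostKernel {b : ℝ} (hb : 0 < b) {V : ℝ → ℝ} (hV : ClassA b V)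
    {f : ℝ → ℂ} (hf : ContinuousOn f (Ici 0)) {k : ℂ} (hk : k ≠ 0) {x : ℝ} (hx : x ∈ Icc 0 b) :
    k * ∫ y in x..b, jostKernel k (y - x) * (V y : ℂ) * f y =
      (∫ y in b..x, Complex.cos (k * y) * (V y : ℂ) * f y) * Complex.sin (k * x)
        - (∫ y in b..x, Complex.sin (k * y) * (V y : ℂ) * f y) * Complex.cos (k * x) := by
  have hsub : uIcc b x ⊆ uIcc 0 b := by
    rw [uIcc_of_ge hx.2, uIcc_of_le hb.le]
    exact Icc_subset_Icc_left hx.1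
  have hc := (hV.intervalIntegrable_mul hb hf
    (g := fun y : ℝ ↦ Complex.cos (k * y)) (by fun_prop)).mono_set hsub
  have hs := (hV.intervalIntegrable_mul hb hf
    (g := fun y : ℝ ↦ Complex.sin (k * y)) (by fun_prop)).mono_set hsub
  rw [intervalIntegral.integral_symm, mul_neg, ← intervalIntegral.integral_const_mul,
    ← intervalIntegral.integral_mul_const, ← intervalIntegral.integral_mul_const,
    ← intervalIntegral.integral_sub (hc.mul_const _) (hs.mul_const _),
    ← intervalIntegral.integral_neg]
  congr 1
  ext y
  simp only [jostKernel, if_neg hk, Complex.ofReal_sub, mul_sub, Complex.sin_sub]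
  field_simp
  ring

/-- The Wronskian of the two Jost solutions at `0`, expressed through the moments of `V f`
against `sin (k y)` and `cos (k y)`. -/
theorem jost_moment_identity {b : ℝ} (hb : 0 < b) {V : ℝ → ℝ} (hV : ClassA b V)
    {k : ℂ} (hk : k ≠ 0) {fp fm : ℝ → ℂ} (hfp : IsJostSolution b V k fp)
    (hfm : IsJostSolution b V (-k) fm) :
    (∫ y in b..0, Complex.cos (k * y) * (V y : ℂ) * fp y)
          * (∫ y in b..0, Complex.sin (k * y) * (V y : ℂ) * fm y)
        - (∫ y in b..0, Complex.cos (k * y) * (V y : ℂ) * fm y)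
          * (∫ y in b..0, Complex.sin (k * y) * (V y : ℂ) * fp y)
        + k * (Complex.I * ((∫ y in b..0, Complex.sin (k * y) * (V y : ℂ) * fp y)
            + ∫ y in b..0, Complex.sin (k * y) * (V y : ℂ) * fm y)
          - (∫ y in b..0, Complex.cos (k * y) * (V y : ℂ) * fp y)
          + ∫ y in b..0, Complex.cos (k * y) * (V y : ℂ) * fm y) = 0 := by
  have hcp := hV.intervalIntegrable_mul hb hfp.1
    (g := fun y : ℝ ↦ Complex.cos (k * y)) (by fun_prop)
  have hsp := hV.intervalIntegrable_mul hb hfp.1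
    (g := fun y : ℝ ↦ Complex.sin (k * y)) (by fun_prop)
  have hcm := hV.intervalIntegrable_mul hb hfm.1
    (g := fun y : ℝ ↦ Complex.cos (k * y)) (by fun_prop)
  have hsm := hV.intervalIntegrable_mul hb hfm.1
    (g := fun y : ℝ ↦ Complex.sin (k * y)) (by fun_prop)
  have hbmem : b ∈ uIcc 0 b := right_mem_uIcc
  have acp := hcp.absolutelyContinuousOnInterval_integral_complex hbmem
  have asp := hsp.absolutelyContinuousOnInterval_integral_complex hbmem
  have acm := hcm.absolutelyContinuousOnInterval_integral_complex hbmem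
  have asm := hsm.absolutelyContinuousOnInterval_integral_complex hbmem
  have hac := ((acp.smul asm).sub (acm.smul asp)).add
    (((((asp.add asm).const_smul Complex.I).sub acp).add acm).const_smul k)
  obtain ⟨C, hC⟩ := hac.const_of_ae_hasDerivAt_zero (by
    filter_upwards [hcp.ae_hasDerivAt_integral, hsp.ae_hasDerivAt_integral,
      hcm.ae_hasDerivAt_integral, hsm.ae_hasDerivAt_integral] with x dcp dsp dcm dsm hx
    have hx' : x ∈ Icc 0 b := by rwa [uIcc_of_le hb.le] at hx
    have hp := hfp.2.1 x hx'.1 hx'.2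
    have hm := hfm.2.1 x hx'.1 hx'.2
    simp only [jostKernel_neg] at hm
    have kp := hV.mul_integral_jostKernel hb hfp.1 hk hx'
    have km := hV.mul_integral_jostKernel hb hfm.1 hk hx'
    have ep : Complex.exp (Complex.I * k * x)
        = Complex.cos (k * x) + Complex.sin (k * x) * Complex.I := by
      rw [← Complex.exp_mul_I]
      ring_nf
    have em : Complex.exp (Complex.I * -k * x)
        = Complex.cos (k * x) - Complex.sin (k * x) * Complex.I := by
      have h := Complex.exp_mul_I (-(k * x))
      rw [Complex.cos_neg, Complex.sin_neg] at h
      rw [sub_eq_add_neg, ← neg_mul, ← h]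
      ring_nf
    rw [ep] at hp
    rw [em] at hm
    replace dcp := dcp hx b hbmem
    replace dsp := dsp hx b hbmem
    replace dcm := dcm hx b hbmem
    replace dsm := dsm hx b hbmem
    have hd := ((dcp.mul dsm).sub (dcm.mul dsp)).add
      (((((dsp.add dsm).const_mul Complex.I).sub dcp).add dcm).const_mul k)
    refine HasDerivAt.congr_deriv hd ?_
    linear_combination (V x : ℂ) * (k * fp x * hm - k * fm x * hp + fp x * km - fm x * kp))
  refine (hC 0 left_mem_uIcc).trans ?_
  rw [← hC b hbmem]
  simp

/-- the combination `φ(x) = (1/2k)[F(k) f₋(x) - F(-k) f₊(x)]` satisfies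
the regular-solution initial conditions `φ(0) = 1` and `φ'(0) = -c`. -/
theorem regular_solution_initial_conditions (b : ℝ) (hb : 0 < b)
    (V : ℝ → ℝ) (hV : ClassA b V)
    (c : ℝ) (k : ℂ) (hk : k ≠ 0)
    (fp : ℝ → ℂ) (hfp : IsJostSolution b V k fp)
    (fm : ℝ → ℂ) (hfm : IsJostSolution b V (-k) fm)
    (fp0' fm0' : ℂ)
    (hfp0' : fp0' = Complex.I * k
      - ∫ y in (0:ℝ)..b, Complex.cos (k * y) * (V y : ℂ) * fp y)
    (hfm0' : fm0' = -Complex.I * k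
      - ∫ y in (0:ℝ)..b, Complex.cos (k * y) * (V y : ℂ) * fm y)
    (Fp Fm : ℂ)
    (hFp : Fp = -Complex.I * (fp0' + (c : ℂ) * fp 0))
    (hFm : Fm = -Complex.I * (fm0' + (c : ℂ) * fm 0)) :
    (1 / (2 * k)) * (Fp * fm 0 - Fm * fp 0) = 1 ∧
    (1 / (2 * k)) * (Fp * fm0' - Fm * fp0') = -(c : ℂ) := by
  have hW := jost_moment_identity hb hV hk hfp hfm
  have hp := hfp.2.1 0 le_rfl hb.le
  have hm := hfm.2.1 0 le_rfl hb.le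
  simp only [jostKernel_neg] at hm
  have kp := hV.mul_integral_jostKernel hb hfp.1 hk (left_mem_Icc.2 hb.le)
  have km := hV.mul_integral_jostKernel hb hfm.1 hk (left_mem_Icc.2 hb.le)
  rw [intervalIntegral.integral_symm] at hfp0' hfm0'
  generalize (∫ y in b..0, Complex.cos (k * y) * (V y : ℂ) * fp y) = Cp at *
  generalize (∫ y in b..0, Complex.cos (k * y) * (V y : ℂ) * fm y) = Cm at *
  generalize (∫ y in b..0, Complex.sin (k * y) * (V y : ℂ) * fp y) = Sp at *
  generalize (∫ y in b..0, Complex.sin (k * y) * (V y : ℂ) * fm y) = Sm at *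
  simp only [Complex.ofReal_zero, mul_zero, Complex.exp_zero, Complex.sin_zero,
    Complex.cos_zero, mul_one, zero_sub] at hp hm kp km
  have hp' : k * fp 0 = k - Sp := by linear_combination k * hp + kp
  have hm' : k * fm 0 = k - Sm := by linear_combination k * hm + km
  have hI := Complex.I_sq
  have hwronskian : fp0' * fm 0 - fm0' * fp 0 = 2 * Complex.I * k := by
    apply mul_left_cancel₀ hk
    subst hfp0' hfm0'
    linear_combination (Complex.I * k + Cp) * hm' - (-Complex.I * k + Cm) * hp' - hW
  subst hFp hFm
  constructor
  · field_simp
    linear_combination -Complex.I * hwronskian - 2 * k * hI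
  · field_simp
    linear_combination c * Complex.I * hwronskian + 2 * k * c * hI
end
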